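/- Let (ν_n, v_{1,n}, v_{2,n}, λ_{1,n}, λ_{2,n}) be a sequence of nontrivial monotone solutions of the one-dimensional system (v_{1,n} decreasing, v_{2,n} increasing) with ν_n → 0. Then there exists a constant C_∞ > 0, independent of n, such that ‖v_{i,n}‖_∞ ≤ C_∞ for i = 1,2 and all n. -/

import Mathlib

open Set Filter MeasureTheory

/-- Assumptions on the interaction functions `g`: `C²` on `[0,∞)`, strictly
increasing there, and `Cg⁻¹ s ≤ g s ≤ Cg s` for all `s ≥ 0`. -/
def GAss (Cg : ℝ) (g : ℝ → ℝ) : Prop :=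
  ContDiffOn ℝ 2 g (Set.Ici 0) ∧ StrictMonoOn g (Set.Ici 0) ∧
    ∀ s : ℝ, 0 ≤ s → Cg⁻¹ * s ≤ g s ∧ g s ≤ Cg * s

/-- A solution of the one-dimensional system with viscosity `ν`:
`v₁, v₂` twice continuously differentiable, satisfying the ODEs on `[0,1]`,
positive on `[0,1]`, with Neumann boundary conditions and unit `L²` mass. -/
def IsSolution (ν : ℝ) (g₁ g₂ v₁ v₂ : ℝ → ℝ) (l₁ l₂ : ℝ) : Prop :=
  ContDiff ℝ 2 v₁ ∧ ContDiff ℝ 2 v₂ ∧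
    (∀ x ∈ Set.Icc (0:ℝ) 1,
      -ν * deriv (deriv v₁) x + g₁ ((v₂ x) ^ 2) * v₁ x = l₁ * v₁ x) ∧
    (∀ x ∈ Set.Icc (0:ℝ) 1,
      -ν * deriv (deriv v₂) x + g₂ ((v₁ x) ^ 2) * v₂ x = l₂ * v₂ x) ∧
    (∀ x ∈ Set.Icc (0:ℝ) 1, 0 < v₁ x) ∧
    (∀ x ∈ Set.Icc (0:ℝ) 1, 0 < v₂ x) ∧
    deriv v₁ 0 = 0 ∧ deriv v₁ 1 = 0 ∧ deriv v₂ 0 = 0 ∧ deriv v₂ 1 = 0 ∧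
    (∫ x in (0:ℝ)..1, (v₁ x) ^ 2) = 1 ∧ (∫ x in (0:ℝ)..1, (v₂ x) ^ 2) = 1

/-- The trivial (constant) solution: `v₁ ≡ v₂ ≡ 1` on `[0,1]`. -/
def IsTrivialSol (v₁ v₂ : ℝ → ℝ) : Prop :=
  ∀ x ∈ Set.Icc (0:ℝ) 1, v₁ x = 1 ∧ v₂ x = 1

lemma aux_mvt_le {f f' : ℝ → ℝ} {a b c : ℝ} (hab : a ≤ b)
    (hf : ∀ x, HasDerivAt f (f' x) x) (hc : ∀ x ∈ Icc a b, c ≤ f' x) :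
    c * (b - a) ≤ f b - f a := by
  refine (convex_Icc a b).mul_sub_le_image_sub_of_le_deriv
    (fun x _ => (hf x).continuousAt.continuousWithinAt)
    (fun x _ => (hf x).differentiableAt.differentiableWithinAt) ?_ a
    (left_mem_Icc.2 hab) b (right_mem_Icc.2 hab) hab
  intro x hx
  rw [(hf x).deriv]
  exact hc x (interior_subset hx)

lemma aux_mvt_ge {f f' : ℝ → ℝ} {a b c : ℝ} (hab : a ≤ b)
    (hf : ∀ x, HasDerivAt f (f' x) x) (hc : ∀ x ∈ Icc a b, f' x ≤ c) :
    f b - f a ≤ c * (b - a) := by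
  have h := aux_mvt_le (f := fun x => - f x) (f' := fun x => - f' x) (c := -c) hab
    (fun x => (hf x).neg) (fun x hx => neg_le_neg (hc x hx))
  linarith

lemma aux_quad {f f' f'' : ℝ → ℝ} {b c : ℝ} (hb : 0 ≤ b)
    (hf : ∀ x, HasDerivAt f (f' x) x) (hf' : ∀ x, HasDerivAt f' (f'' x) x)
    (h0 : f' 0 = 0) (hc : ∀ x ∈ Icc 0 b, c ≤ f'' x) :
    f 0 + c * b ^ 2 / 2 ≤ f b := by
  have h1 : ∀ x ∈ Icc 0 b, 0 ≤ f' x - c * x := by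
    intro x hx
    have := aux_mvt_le hx.1 hf' (fun y hy => hc y ⟨hy.1, hy.2.trans hx.2⟩)
    linarith
  have h2 := aux_mvt_le (f := fun x => f x - c * x ^ 2 / 2) (f' := fun x => f' x - c * x)
    (c := 0) hb (fun x => by
      have := (hf x).sub ((((hasDerivAt_id x).pow 2).const_mul c).div_const 2)
      refine this.congr_deriv ?_
      simp; ring) h1
  linarith

/-- Working version of the system, with explicit derivatives and mass functions. -/
structure Sol (C ν : ℝ) (g1 g2 v v' v'' w w' w'' A B : ℝ → ℝ) (l1 l2 : ℝ) : Prop where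
  hC : 1 ≤ C
  hν : 0 < ν
  g1b : ∀ s, 0 ≤ s → s ≤ C * g1 s ∧ g1 s ≤ C * s
  g2b : ∀ s, 0 ≤ s → s ≤ C * g2 s ∧ g2 s ≤ C * s
  g1m : MonotoneOn g1 (Ici 0)
  g2m : MonotoneOn g2 (Ici 0)
  dv : ∀ x, HasDerivAt v (v' x) x
  dv' : ∀ x, HasDerivAt v' (v'' x) x
  dw : ∀ x, HasDerivAt w (w' x) x
  dw' : ∀ x, HasDerivAt w' (w'' x) x
  dA : ∀ x, HasDerivAt A (v x ^ 2) x
  dB : ∀ x, HasDerivAt B (w x ^ 2) x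
  A0 : A 0 = 0
  A1 : A 1 = 1
  B0 : B 0 = 0
  B1 : B 1 = 1
  ev : ∀ x ∈ Icc (0:ℝ) 1, ν * v'' x = (g1 (w x ^ 2) - l1) * v x
  ew : ∀ x ∈ Icc (0:ℝ) 1, ν * w'' x = (g2 (v x ^ 2) - l2) * w x
  pv : ∀ x ∈ Icc (0:ℝ) 1, 0 < v x
  pw : ∀ x ∈ Icc (0:ℝ) 1, 0 < w x
  v0 : v' 0 = 0
  v1 : v' 1 = 0
  w0 : w' 0 = 0
  w1 : w' 1 = 0
  nv : ∀ x ∈ Icc (0:ℝ) 1, v' x ≤ 0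
  nw : ∀ x ∈ Icc (0:ℝ) 1, 0 ≤ w' x
  av : AntitoneOn v (Icc 0 1)
  mw : MonotoneOn w (Icc 0 1)

lemma aux_refl {f f' : ℝ → ℝ} (hf : ∀ x, HasDerivAt f (f' x) x) (x : ℝ) :
    HasDerivAt (fun x => f (1 - x)) (- f' (1 - x)) x := by
  have h1 : HasDerivAt (fun x : ℝ => 1 - x) (-1) x := by
    simpa using (hasDerivAt_id x).const_sub 1
  have := (hf (1 - x)).comp x h1
  simpa [Function.comp_def] using this

namespace Sol

variable {C ν : ℝ} {g1 g2 v v' v'' w w' w'' A B : ℝ → ℝ} {l1 l2 : ℝ}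

lemma swap (S : Sol C ν g1 g2 v v' v'' w w' w'' A B l1 l2) :
    Sol C ν g2 g1 (fun x => w (1 - x)) (fun x => - w' (1 - x)) (fun x => w'' (1 - x))
      (fun x => v (1 - x)) (fun x => - v' (1 - x)) (fun x => v'' (1 - x))
      (fun x => 1 - B (1 - x)) (fun x => 1 - A (1 - x)) l2 l1 := by
  have hm : ∀ x ∈ Icc (0:ℝ) 1, 1 - x ∈ Icc (0:ℝ) 1 := fun x hx =>
    ⟨by linarith [hx.2], by linarith [hx.1]⟩
  exact
  { hC := S.hC, hν := S.hν, g1b := S.g2b, g2b := S.g1b, g1m := S.g2m, g2m := S.g1m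
    dv := aux_refl S.dw
    dv' := fun x => (aux_refl S.dw' x).neg.congr_deriv (neg_neg _)
    dw := aux_refl S.dv
    dw' := fun x => (aux_refl S.dv' x).neg.congr_deriv (neg_neg _)
    dA := fun x => by simpa using (aux_refl S.dB x).const_sub 1
    dB := fun x => by simpa using (aux_refl S.dA x).const_sub 1
    A0 := by simp [S.B1]
    A1 := by simp [S.B0]
    B0 := by simp [S.A1]
    B1 := by simp [S.A0]
    ev := fun x hx => S.ew _ (hm x hx)
    ew := fun x hx => S.ev _ (hm x hx)
    pv := fun x hx => S.pw _ (hm x hx)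
    pw := fun x hx => S.pv _ (hm x hx)
    v0 := by simp [S.w1]
    v1 := by simp [S.w0]
    w0 := by simp [S.v1]
    w1 := by simp [S.v0]
    nv := fun x hx => by have := S.nw _ (hm x hx); linarith
    nw := fun x hx => by have := S.nv _ (hm x hx); linarith
    av := fun x hx y hy hxy => S.mw (hm y hy) (hm x hx) (by linarith)
    mw := fun x hx y hy hxy => S.av (hm y hy) (hm x hx) (by linarith) }

lemma exists_c (S : Sol C ν g1 g2 v v' v'' w w' w'' A B l1 l2) :
    ∃ c ∈ Icc (0:ℝ) 1, g1 (w c ^ 2) = l1 := by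
  obtain ⟨c, hc, h⟩ := exists_hasDerivAt_eq_zero (f := v') (f' := v'') zero_lt_one
    (fun x _ => (S.dv' x).continuousAt.continuousWithinAt) (by rw [S.v0, S.v1])
    (fun x _ => S.dv' x)
  have hc' : c ∈ Icc (0:ℝ) 1 := ⟨hc.1.le, hc.2.le⟩
  refine ⟨c, hc', ?_⟩
  have h1 := S.ev c hc'
  rw [h, mul_zero] at h1
  have := S.pv c hc'
  rcases mul_eq_zero.1 h1.symm with h | h
  · linarith
  · linarith

lemma l1_pos (S : Sol C ν g1 g2 v v' v'' w w' w'' A B l1 l2) : 0 < l1 := by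
  obtain ⟨c, hc, h⟩ := S.exists_c
  have h1 := (S.g1b (w c ^ 2) (sq_nonneg _)).1
  rw [h] at h1
  have := pow_pos (S.pw c hc) 2
  have hC := S.hC
  by_contra hl
  push Not at hl
  nlinarith

lemma l2_pos (S : Sol C ν g1 g2 v v' v'' w w' w'' A B l1 l2) : 0 < l2 := S.swap.l1_pos

lemma v_sq (S : Sol C ν g1 g2 v v' v'' w w' w'' A B l1 l2) {x : ℝ} (hx : x ∈ Icc (0:ℝ) 1) :
    v x ^ 2 * x ≤ 1 := by
  have h1 := aux_mvt_le (c := v x ^ 2) hx.1 S.dA (fun y hy => by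
    have hy1 : y ∈ Icc (0:ℝ) 1 := ⟨hy.1, hy.2.trans hx.2⟩
    exact pow_le_pow_left₀ (S.pv x hx).le (S.av hy1 hx hy.2) 2)
  have h2 := aux_mvt_le (c := 0) hx.2 S.dA (fun y hy => sq_nonneg _)
  rw [S.A0] at h1
  rw [S.A1] at h2
  linarith

lemma w_sq (S : Sol C ν g1 g2 v v' v'' w w' w'' A B l1 l2) {x : ℝ} (hx : x ∈ Icc (0:ℝ) 1) :
    w x ^ 2 * (1 - x) ≤ 1 := by
  have := S.swap.v_sq (x := 1 - x) ⟨by linarith [hx.2], by linarith [hx.1]⟩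
  simpa using this

/-- Bound on the multiplier. -/
lemma l1_le (S : Sol C ν g1 g2 v v' v'' w w' w'' A B l1 l2) : l1 ≤ C := by
  have hν := S.hν
  have hcont : ContinuousOn (fun x => C * B x - l1 * x - ν * (v' x / v x)) (Icc 0 1) := by
    intro x hx
    have := (S.dv' x).continuousAt.div (S.dv x).continuousAt (S.pv x hx).ne'
    have hB := (S.dB x).continuousAt
    exact (((hB.const_mul C).sub (continuousAt_id.const_mul l1)).sub
      (this.const_mul ν)).continuousWithinAt
  have hd : ∀ x ∈ Icc (0:ℝ) 1, HasDerivAt (fun x => C * B x - l1 * x - ν * (v' x / v x))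
      (C * w x ^ 2 - l1 - ν * ((v'' x * v x - v' x * v' x) / v x ^ 2)) x := by
    intro x hx
    have := (S.dv' x).div (S.dv x) (S.pv x hx).ne'
    have h2 := (((S.dB x).const_mul C).sub ((hasDerivAt_id x).const_mul l1)).sub
      (this.const_mul ν)
    exact h2.congr_deriv (by simp)
  have hmon : MonotoneOn (fun x => C * B x - l1 * x - ν * (v' x / v x)) (Icc 0 1) := by
    refine monotoneOn_of_deriv_nonneg (convex_Icc 0 1) hcont
      (fun x hx => (hd x (interior_subset hx)).differentiableAt.differentiableWithinAt) ?_
    intro x hx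
    have hx := interior_subset hx
    rw [(hd x hx).deriv]
    have hp := S.pv x hx
    have he := S.ev x hx
    have hg := (S.g1b (w x ^ 2) (sq_nonneg _)).2
    have e : ν * ((v'' x * v x - v' x * v' x) / v x ^ 2)
        = (g1 (w x ^ 2) - l1) - ν * (v' x / v x) ^ 2 := by
      have : ν * ((v'' x * v x - v' x * v' x) / v x ^ 2)
        = (ν * v'' x) / v x - ν * (v' x / v x) ^ 2 := by
        field_simp
      rw [this, he]
      field_simp
    rw [e]
    have := mul_nonneg hν.le (sq_nonneg (v' x / v x))
    linarith
  have := hmon (left_mem_Icc.2 zero_le_one) (right_mem_Icc.2 zero_le_one) zero_le_one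
  simp only [S.v0, S.v1, S.B0, S.B1] at this
  norm_num at this
  linarith

lemma l2_le (S : Sol C ν g1 g2 v v' v'' w w' w'' A B l1 l2) : l2 ≤ C := S.swap.l1_le

lemma v_low (S : Sol C ν g1 g2 v v' v'' w w' w'' A B l1 l2) {x : ℝ} (hx : x ∈ Icc (0:ℝ) 1)
    (h : l1 * x ^ 2 ≤ ν) : v 0 / 2 ≤ v x := by
  have hν := S.hν
  have hl := S.l1_pos
  have hM := S.pv 0 (left_mem_Icc.2 zero_le_one)
  have h1 := aux_quad (c := -(l1 * v 0) / ν) hx.1 S.dv S.dv' S.v0 (fun y hy => by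
    have hy1 : y ∈ Icc (0:ℝ) 1 := ⟨hy.1, hy.2.trans hx.2⟩
    rw [div_le_iff₀ hν, mul_comm (v'' y), S.ev y hy1]
    have h2 := S.av (left_mem_Icc.2 zero_le_one) hy1 hy.1
    have h3 := S.pv y hy1
    have hC := S.hC
    have h4 : 0 ≤ g1 (w y ^ 2) := by
      have := (S.g1b (w y ^ 2) (sq_nonneg _)).1
      have := sq_nonneg (w y)
      by_contra hh
      push Not at hh
      nlinarith
    nlinarith [mul_nonneg h4 h3.le, mul_le_mul_of_nonneg_left h2 hl.le])
  have h5 : -(l1 * v 0) / ν * x ^ 2 / 2 = - (v 0 / 2) * (l1 * x ^ 2 / ν) := by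
    field_simp
  have h6 : l1 * x ^ 2 / ν ≤ 1 := by rw [div_le_one hν]; exact h
  rw [h5] at h1
  nlinarith

/-- If the peak is large then the multiplier dominates `ν`. -/
lemma l1_big (S : Sol C ν g1 g2 v v' v'' w w' w'' A B l1 l2) (hM2 : 2 < v 0) :
    ν < l1 ∧ ν * v 0 ^ 4 ≤ 16 * l1 := by
  have hν := S.hν
  have hl := S.l1_pos
  have h1 : ν < l1 := by
    by_contra hh
    push Not at hh
    have := S.v_low (x := 1) (right_mem_Icc.2 zero_le_one) (by linarith)
    have h2 := S.v_sq (right_mem_Icc.2 zero_le_one)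
    nlinarith
  refine ⟨h1, ?_⟩
  have hr0 : 0 ≤ √(ν / l1) := Real.sqrt_nonneg _
  have hr2 : √(ν / l1) ^ 2 = ν / l1 := Real.sq_sqrt (by positivity)
  have hrm : √(ν / l1) ∈ Icc (0:ℝ) 1 := by
    refine ⟨hr0, ?_⟩
    rw [Real.sqrt_le_left zero_le_one, one_pow, div_le_one hl]
    exact h1.le
  set r := √(ν / l1)
  have hlr : l1 * r ^ 2 = ν := by rw [hr2]; field_simp
  have h3 := S.v_low hrm hlr.le
  have h4 := S.v_sq hrm
  have h5 : v 0 ^ 2 * r ≤ 4 := by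
    have : (v 0 / 2) ^ 2 ≤ v r ^ 2 := pow_le_pow_left₀ (by linarith) h3 2
    nlinarith
  have h6 : (v 0 ^ 2 * r) ^ 2 ≤ 4 ^ 2 := pow_le_pow_left₀ (by positivity) h5 2
  rw [← hlr]
  nlinarith

lemma w0_small (S : Sol C ν g1 g2 v v' v'' w w' w'' A B l1 l2) (hM2 : 2 < v 0)
    (hM : 16384 * C ^ 6 ≤ v 0 ^ 2) : C * w 0 ^ 2 * v 0 ^ 2 ≤ l1 := by
  have hν := S.hν
  have hC := S.hC
  have hl := S.l1_pos
  have hl2 := S.l2_le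
  have hl1C := S.l1_le
  obtain ⟨h1, -⟩ := S.l1_big hM2
  have hr0 : 0 ≤ √(ν / l1) := Real.sqrt_nonneg _
  have hrp : 0 < √(ν / l1) := Real.sqrt_pos.2 (by positivity)
  have hr2 : √(ν / l1) ^ 2 = ν / l1 := Real.sq_sqrt (by positivity)
  have hrm : √(ν / l1) ∈ Icc (0:ℝ) 1 := by
    refine ⟨hr0, ?_⟩
    rw [Real.sqrt_le_left zero_le_one, one_pow, div_le_one hl]
    exact h1.le
  set r := √(ν / l1)
  have hlr : l1 * r ^ 2 = ν := by rw [hr2]; field_simp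
  have hC2 : C ^ 2 ≤ C ^ 6 := pow_le_pow_right₀ hC (by norm_num)
  have hvl : ∀ y ∈ Icc (0:ℝ) r, v 0 / 2 ≤ v y := by
    intro y hy
    refine S.v_low ⟨hy.1, hy.2.trans hrm.2⟩ ?_
    rw [← hlr]
    exact mul_le_mul_of_nonneg_left (pow_le_pow_left₀ hy.1 hy.2 2) hl.le
  have hhm : r / 2 ∈ Icc (0:ℝ) 1 := ⟨by linarith, by linarith [hrm.2]⟩
  have hq := S.pw _ hhm
  have hw0 := S.pw 0 (left_mem_Icc.2 zero_le_one)
  -- bound for w (r/2)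
  have hqb : w (r / 2) ^ 2 ≤ 4 * C * l1 := by
    have hd : ∀ x, HasDerivAt (fun x => ν * v' x) (ν * v'' x) x := fun x => (S.dv' x).const_mul ν
    have ha := aux_mvt_le (c := - (l1 * v 0)) (a := 0) (b := r / 2) (by linarith) hd (fun y hy => by
      have hy1 : y ∈ Icc (0:ℝ) 1 := ⟨hy.1, hy.2.trans hhm.2⟩
      rw [S.ev y hy1]
      have h2 := S.av (left_mem_Icc.2 zero_le_one) hy1 hy.1
      have h3 := S.pv y hy1
      have h4 : 0 ≤ C * g1 (w y ^ 2) := (sq_nonneg _).trans (S.g1b (w y ^ 2) (sq_nonneg _)).1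
      have h4 : 0 ≤ g1 (w y ^ 2) := nonneg_of_mul_nonneg_right h4 (by linarith)
      nlinarith [mul_nonneg h4 h3.le, mul_le_mul_of_nonneg_left h2 hl.le])
    have hb := aux_mvt_le (c := w (r/2) ^ 2 / C * (v 0 / 2) - (l1 * v 0)) (a := r / 2) (b := r)
      (by linarith) hd (fun y hy => by
      have hy0 : 0 ≤ y := by linarith [hy.1]
      have hy1 : y ∈ Icc (0:ℝ) 1 := ⟨hy0, hy.2.trans hrm.2⟩
      rw [S.ev y hy1]
      have h2 := S.av (left_mem_Icc.2 zero_le_one) hy1 hy0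
      have h3 := hvl y ⟨hy0, hy.2⟩
      have h5 : w (r/2) ^ 2 ≤ w y ^ 2 := pow_le_pow_left₀ hq.le (S.mw hhm hy1 hy.1) 2
      have h4 := (S.g1b (w y ^ 2) (sq_nonneg _)).1
      have h6 : w (r/2) ^ 2 / C ≤ g1 (w y ^ 2) := by
        rw [div_le_iff₀ (by linarith)]; linarith
      have h7 : 0 ≤ w (r/2) ^ 2 / C := by positivity
      have := mul_le_mul h6 h3 (by linarith) (h7.trans h6)
      have := mul_le_mul_of_nonneg_left h2 hl.le
      linarith)
    simp only [S.v0] at ha hb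
    have hvr := mul_nonpos_of_nonneg_of_nonpos hν.le (S.nv r hrm)
    have hc : (w (r/2) ^ 2 / C / 4) * (v 0 * r) ≤ l1 * (v 0 * r) := by nlinarith
    have hc := le_of_mul_le_mul_right hc (by positivity)
    rw [div_le_iff₀ (by norm_num), div_le_iff₀ (by linarith)] at hc
    linarith
  have hgrow := aux_quad (c := v 0 ^ 2 / (8 * C) * w 0 / ν) hhm.1 S.dw S.dw' S.w0 (fun y hy => by
    have hy1 : y ∈ Icc (0:ℝ) 1 := ⟨hy.1, hy.2.trans hhm.2⟩
    rw [div_le_iff₀ hν, mul_comm (w'' y), S.ew y hy1]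
    have h3 := hvl y ⟨hy.1, by linarith [hy.2]⟩
    have h2 := S.mw (left_mem_Icc.2 zero_le_one) hy1 hy.1
    have h4 := (S.g2b (v y ^ 2) (sq_nonneg _)).1
    have h5 : (v 0 / 2) ^ 2 ≤ v y ^ 2 := pow_le_pow_left₀ (by linarith) h3 2
    have h6 : v 0 ^ 2 / (8 * C) ≤ g2 (v y ^ 2) - l2 := by
      rw [div_le_iff₀ (by linarith)]
      nlinarith
    exact mul_le_mul h6 h2 hw0.le (le_trans (by positivity) h6))
  have e1 : v 0 ^ 2 / (8 * C) * w 0 / ν * (r / 2) ^ 2 / 2 = w 0 * v 0 ^ 2 / (64 * C * l1) := by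
    rw [← hlr]; field_simp; norm_num
  rw [e1] at hgrow
  have h8 : w 0 * v 0 ^ 2 ≤ w (r/2) * (64 * C * l1) := by
    rw [← div_le_iff₀ (by positivity)]; linarith
  have h9 : (w 0 * v 0 ^ 2) ^ 2 ≤ (w (r/2) * (64 * C * l1)) ^ 2 :=
    pow_le_pow_left₀ (by positivity) h8 2
  have h10 : (w (r/2) * (64 * C * l1)) ^ 2 ≤ 16384 * C ^ 5 * l1 := by
    calc (w (r/2) * (64 * C * l1)) ^ 2 = w (r/2) ^ 2 * (4096 * C ^ 2 * l1 ^ 2) := by ring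
      _ ≤ (4 * C * l1) * (4096 * C ^ 2 * l1 ^ 2) := by gcongr
      _ = 16384 * C ^ 3 * l1 * l1 ^ 2 := by ring
      _ ≤ 16384 * C ^ 3 * l1 * C ^ 2 := by gcongr
      _ = _ := by ring
  have h11 : (C * w 0 ^ 2 * v 0 ^ 2) * v 0 ^ 2 ≤ l1 * v 0 ^ 2 := by
    calc (C * w 0 ^ 2 * v 0 ^ 2) * v 0 ^ 2 = C * (w 0 * v 0 ^ 2) ^ 2 := by ring
      _ ≤ C * (16384 * C ^ 5 * l1) := by gcongr; exact h9.trans h10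
      _ = l1 * (16384 * C ^ 6) := by ring
      _ ≤ _ := by gcongr
  exact le_of_mul_le_mul_right h11 (by positivity)

/-- The pseudo-Hamiltonian inequality. -/
lemma ham (S : Sol C ν g1 g2 v v' v'' w w' w'' A B l1 l2) {x : ℝ} (hx : x ∈ Icc (0:ℝ) 1) :
    l1 * v 0 ^ 2 ≤ C * w 0 ^ 2 * v 0 ^ 2 + ν * v' x ^ 2 + l1 * v x ^ 2
      + C ^ 2 * (ν * w' x ^ 2 + l2 * w x ^ 2) := by
  have hC := S.hC
  have hd : ∀ y, HasDerivAt (fun y => ν * v' y ^ 2 + l1 * v y ^ 2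
      + C ^ 2 * (ν * w' y ^ 2 + l2 * w y ^ 2) - C * (v y ^ 2 * w y ^ 2))
      (2 * v' y * (ν * v'' y) + 2 * l1 * v y * v' y
        + C ^ 2 * (2 * w' y * (ν * w'' y) + 2 * l2 * w y * w' y)
        - C * (2 * v y * v' y * w y ^ 2 + v y ^ 2 * (2 * w y * w' y))) y := by
    intro y
    have h1 := (((S.dv' y).pow 2).const_mul ν).add (((S.dv y).pow 2).const_mul l1)
    have h2 := ((((S.dw' y).pow 2).const_mul ν).add (((S.dw y).pow 2).const_mul l2)).const_mul
      (C ^ 2)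
    have h3 := (((S.dv y).pow 2).mul ((S.dw y).pow 2)).const_mul C
    have := (h1.add h2).sub h3
    refine this.congr_deriv ?_
    simp
    ring
  have h := aux_mvt_le (c := 0) hx.1 hd (fun y hy => by
    have hy1 : y ∈ Icc (0:ℝ) 1 := ⟨hy.1, hy.2.trans hx.2⟩
    rw [S.ev y hy1, S.ew y hy1]
    have a1 := (S.g1b (w y ^ 2) (sq_nonneg _)).2
    have a2 := (S.g2b (v y ^ 2) (sq_nonneg _)).1
    have b1 := mul_nonneg (S.pv y hy1).le (neg_nonneg.2 (S.nv y hy1))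
    have b2 := mul_nonneg (S.pw y hy1).le (S.nw y hy1)
    have c1 := mul_nonneg (sub_nonneg.2 a1) b1
    have c2 := mul_nonneg (mul_nonneg (by linarith : 0 ≤ C) (sub_nonneg.2 a2)) b2
    nlinarith)
  simp only [S.v0, S.w0] at h
  have p1 : 0 ≤ C ^ 2 * (l2 * w 0 ^ 2) := by have := S.l2_pos; positivity
  have p2 : 0 ≤ C * (v x ^ 2 * w x ^ 2) := by positivity
  nlinarith

/-- A large peak forces convexity on `[1/4,1]`. -/
lemma conv (S : Sol C ν g1 g2 v v' v'' w w' w'' A B l1 l2) (hM2 : 32 < v 0 ^ 2) :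
    ∀ y ∈ Icc (1/4 : ℝ) 1, 0 ≤ v'' y := by
  have hν := S.hν
  obtain ⟨c, hc, hcl⟩ := S.exists_c
  have hclt : c < 1 / 4 := by
    by_contra hh
    push Not at hh
    have hneg : ∀ y ∈ Icc (0:ℝ) (1/4), v'' y ≤ 0 := by
      intro y hy
      have hy1 : y ∈ Icc (0:ℝ) 1 := ⟨hy.1, by linarith [hy.2]⟩
      have h1 := S.ev y hy1
      have h2 : g1 (w y ^ 2) ≤ g1 (w c ^ 2) := S.g1m (mem_Ici.2 (sq_nonneg _)) (mem_Ici.2 (sq_nonneg _))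
        (pow_le_pow_left₀ (S.pw y hy1).le (S.mw hy1 hc (hy.2.trans hh)) 2)
      have h3 := S.pv y hy1
      by_contra h4
      push Not at h4
      have := mul_pos hν h4
      nlinarith
    have e : (1/8:ℝ) ∈ Icc (0:ℝ) 1 := by constructor <;> norm_num
    have e' : (1/4:ℝ) ∈ Icc (0:ℝ) 1 := by constructor <;> norm_num
    have m1 := aux_mvt_le (c := v' (1/8)) (a := 0) (b := 1/8) (by norm_num) S.dv (fun y hy => by
      have := aux_mvt_ge (c := 0) hy.2 S.dv' (fun z hz =>
        hneg z ⟨by linarith [hz.1, hy.1], by linarith [hz.2]⟩)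
      linarith)
    have m2 := aux_mvt_ge (c := v' (1/8)) (a := 1/8) (b := 1/4) (by norm_num) S.dv (fun y hy => by
      have := aux_mvt_ge (c := 0) hy.1 S.dv' (fun z hz =>
        hneg z ⟨by linarith [hz.1], by linarith [hz.2, hy.2]⟩)
      linarith)
    have h8 := S.v_sq e
    have p1 := S.pv _ e'
    have p2 := S.pv _ e
    have p0 := S.pv 0 (left_mem_Icc.2 zero_le_one)
    have : v 0 ≤ 2 * v (1/8) := by linarith
    have : v 0 ^ 2 ≤ (2 * v (1/8)) ^ 2 := pow_le_pow_left₀ p0.le this 2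
    nlinarith
  intro y hy
  have hy1 : y ∈ Icc (0:ℝ) 1 := ⟨by linarith [hy.1], hy.2⟩
  have h1 := S.ev y hy1
  have h2 : g1 (w c ^ 2) ≤ g1 (w y ^ 2) := S.g1m (mem_Ici.2 (sq_nonneg _)) (mem_Ici.2 (sq_nonneg _))
    (pow_le_pow_left₀ (S.pw c hc).le (S.mw hc hy1 (by linarith [hy.1])) 2)
  have h3 := S.pv y hy1
  have : 0 ≤ ν * v'' y := by rw [h1]; exact mul_nonneg (by linarith) h3.le
  exact nonneg_of_mul_nonneg_right this hν

lemma slope (S : Sol C ν g1 g2 v v' v'' w w' w'' A B l1 l2) (hM2 : 32 < v 0 ^ 2)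
    {x : ℝ} (hx : x ∈ Icc (1/2:ℝ) 1) : -8 ≤ v' x := by
  have hconv := S.conv hM2
  have e' : (1/4:ℝ) ∈ Icc (0:ℝ) 1 := by constructor <;> norm_num
  have e : (1/2:ℝ) ∈ Icc (0:ℝ) 1 := by constructor <;> norm_num
  have m1 := aux_mvt_ge (c := v' (1/2)) (a := 1/4) (b := 1/2) (by norm_num) S.dv (fun y hy => by
    have := aux_mvt_le (c := 0) hy.2 S.dv' (fun z hz =>
      hconv z ⟨by linarith [hz.1, hy.1], by linarith [hz.2]⟩)
    linarith)
  have m2 := aux_mvt_le (c := 0) hx.1 S.dv' (fun z hz =>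
      hconv z ⟨by linarith [hz.1], by linarith [hz.2, hx.2]⟩)
  have h := S.v_sq e'
  have := S.pv _ e
  have : v (1/4) ≤ 2 := by nlinarith
  linarith

lemma half (S : Sol C ν g1 g2 v v' v'' w w' w'' A B l1 l2)
    (hM : 320 * C ^ 3 < v 0) (hN : 320 * C ^ 3 < w 1) :
    l1 * v 0 ^ 2 ≤ 4 * C ^ 2 * l2 := by
  have hC := S.hC
  have hν := S.hν
  have hl1 := S.l1_pos
  have hl2 := S.l2_pos
  have hC3 : 1 ≤ C ^ 3 := one_le_pow₀ hC
  have hMsq : 102400 * C ^ 6 ≤ v 0 ^ 2 := by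
    have := pow_le_pow_left₀ (by positivity) hM.le 2
    calc 102400 * C ^ 6 = (320 * C ^ 3) ^ 2 := by ring
      _ ≤ _ := this
  have hNsq : 102400 * C ^ 6 ≤ w 1 ^ 2 := by
    have := pow_le_pow_left₀ (by positivity) hN.le 2
    calc 102400 * C ^ 6 = (320 * C ^ 3) ^ 2 := by ring
      _ ≤ _ := this
  have hC6 : 1 ≤ C ^ 6 := one_le_pow₀ hC
  have hC2 : C ^ 2 ≤ C ^ 6 := pow_le_pow_right₀ hC (by norm_num)
  have hC21 : 1 ≤ C ^ 2 := one_le_pow₀ hC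
  have e : (1/2:ℝ) ∈ Icc (0:ℝ) 1 := by constructor <;> norm_num
  have e' : (1/2:ℝ) ∈ Icc (1/2:ℝ) 1 := by constructor <;> norm_num
  have h1 := S.ham e
  have h2 := S.w0_small (by linarith) (by linarith)
  have h3 := S.slope (by linarith) e'
  have h4 := S.swap.slope (by simp only [sub_zero]; linarith) e'
  norm_num at h4
  have h5 := S.nv _ e
  have h6 := S.nw _ e
  have h7 := S.v_sq e
  have h8 := S.w_sq e
  obtain ⟨-, h9⟩ := S.l1_big (by linarith)
  have h5' : v' (1/2) ^ 2 ≤ 64 := by nlinarith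
  have h6' : w' (1/2) ^ 2 ≤ 64 := by norm_num at h6 ⊢; nlinarith
  have h7' : v (1/2) ^ 2 ≤ 2 := by linarith
  have h8' : w (1/2) ^ 2 ≤ 2 := by linarith
  have h10 : ν ≤ 16 * l1 := by
    have : 1 ≤ v 0 ^ 4 := one_le_pow₀ (by linarith)
    nlinarith
  have q1 : ν * v' (1/2) ^ 2 ≤ 16 * l1 * 64 := by gcongr
  have q2 : ν * w' (1/2) ^ 2 ≤ 16 * l1 * 64 := by gcongr
  have q3 : l1 * v (1/2) ^ 2 ≤ l1 * 2 := by gcongr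
  have q4 : l2 * w (1/2) ^ 2 ≤ l2 * 2 := by gcongr
  have q5 : C ^ 2 * (ν * w' (1/2) ^ 2 + l2 * w (1/2) ^ 2) ≤ C ^ 2 * (16 * l1 * 64 + l2 * 2) := by
    gcongr
  have q6 : l1 * (102400 * C ^ 2) ≤ l1 * v 0 ^ 2 := by gcongr; linarith
  have q7 : l1 * 1 ≤ l1 * C ^ 2 := by gcongr
  nlinarith

lemma not_both (S : Sol C ν g1 g2 v v' v'' w w' w'' A B l1 l2)
    (hM : 320 * C ^ 3 < v 0) (hN : 320 * C ^ 3 < w 1) : False := by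
  have hC := S.hC
  have hl1 := S.l1_pos
  have hl2 := S.l2_pos
  have h1 := S.half hM hN
  have h2 := S.swap.half (by simpa using hN) (by simpa using hM)
  simp only [sub_zero] at h2
  have hC3 : 1 ≤ C ^ 3 := one_le_pow₀ hC
  have hCC : C ≤ C ^ 3 := le_self_pow₀ hC (by norm_num)
  have k1 : (3 * C) ^ 2 < v 0 ^ 2 := pow_lt_pow_left₀ (by linarith) (by linarith) (by norm_num)
  have k2 : (3 * C) ^ 2 < w 1 ^ 2 := pow_lt_pow_left₀ (by linarith) (by linarith) (by norm_num)
  have m1 : l1 * (3 * C) ^ 2 < 4 * C ^ 2 * l2 := (mul_lt_mul_of_pos_left k1 hl1).trans_le h1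
  have m2 : l2 * (3 * C) ^ 2 < 4 * C ^ 2 * l1 := (mul_lt_mul_of_pos_left k2 hl2).trans_le h2
  have : 0 < C ^ 2 := by positivity
  nlinarith [mul_pos this hl1, mul_pos this hl2]

lemma l2_small (S : Sol C ν g1 g2 v v' v'' w w' w'' A B l1 l2) {δ : ℝ}
    (hM2 : 32 < v 0 ^ 2) (hδp : 0 < δ) (hδh : δ ≤ 1 / 2)
    (hvv : ∀ y ∈ Icc (1 - δ) 1, v y ≤ 4 * C * (ν * v'' y)) :
    l2 * δ ^ 3 / 3 ≤ ν * δ + 64 * C ^ 2 * δ ^ 2 * ν := by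
  have hC := S.hC
  have hν := S.hν
  have ex : 1 - δ ∈ Icc (0:ℝ) 1 := ⟨by linarith, by linarith⟩
  have hslope := S.slope hM2 (x := 1 - δ) ⟨by linarith, ex.2⟩
  have hd : ∀ x ∈ Icc (1 - δ) 1, HasDerivAt
      (fun x => 8 * C ^ 2 * δ ^ 2 * ν * v' x + ν * x - l2 * (x - (1 - δ)) ^ 3 / 3
        - ν * (w' x * (x - (1 - δ)) ^ 2 / w x))
      (8 * C ^ 2 * δ ^ 2 * ν * v'' x + ν - l2 * (x - (1 - δ)) ^ 2
        - ν * (((w'' x * (x - (1 - δ)) ^ 2 + w' x * (2 * (x - (1 - δ)))) * w x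
          - w' x * (x - (1 - δ)) ^ 2 * w' x) / w x ^ 2)) x := by
    intro x hx
    have hx1 : x ∈ Icc (0:ℝ) 1 := ⟨ex.1.trans hx.1, hx.2⟩
    have hs : HasDerivAt (fun x : ℝ => x - (1 - δ)) 1 x := (hasDerivAt_id x).sub_const _
    have hs2 : HasDerivAt (fun x : ℝ => (x - (1 - δ)) ^ 2) (2 * (x - (1 - δ))) x := by
      have := hs.pow 2
      exact this.congr_deriv (by norm_num)
    have hs3 : HasDerivAt (fun x : ℝ => (x - (1 - δ)) ^ 3) (3 * (x - (1 - δ)) ^ 2) x := by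
      have := hs.pow 3
      exact this.congr_deriv (by norm_num)
    have t1 := (((S.dw' x).mul hs2).div (S.dw x) (S.pw x hx1).ne').const_mul ν
    have t2 := (S.dv' x).const_mul (8 * C ^ 2 * δ ^ 2 * ν)
    have t3 := (hasDerivAt_id x).const_mul ν
    have t4 := (hs3.const_mul l2).div_const 3
    have := ((t2.add t3).sub t4).sub t1
    refine this.congr_deriv ?_
    simp
    ring
  have hmon : MonotoneOn (fun x => 8 * C ^ 2 * δ ^ 2 * ν * v' x + ν * x
      - l2 * (x - (1 - δ)) ^ 3 / 3 - ν * (w' x * (x - (1 - δ)) ^ 2 / w x)) (Icc (1 - δ) 1) := by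
    refine monotoneOn_of_deriv_nonneg (convex_Icc _ _)
      (fun x hx => (hd x hx).continuousAt.continuousWithinAt)
      (fun x hx => (hd x (interior_subset hx)).differentiableAt.differentiableWithinAt) ?_
    intro x hx
    have hx := interior_subset hx
    have hx1 : x ∈ Icc (0:ℝ) 1 := ⟨ex.1.trans hx.1, hx.2⟩
    rw [(hd x hx).deriv]
    have hp := S.pw x hx1
    have he := S.ew x hx1
    have hg := (S.g2b (v x ^ 2) (sq_nonneg _)).2
    have hvp := S.pv x hx1
    have hv2 : v x ≤ 2 := by
      have h1 := S.v_sq hx1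
      have h2 : 1 / 2 ≤ x := by linarith [hx.1]
      nlinarith only [h1, h2, sq_nonneg (v x), hvp]
    have hvx := hvv x hx
    obtain ⟨φ, hφ⟩ : ∃ φ, φ = x - (1 - δ) := ⟨_, rfl⟩
    have hφ0 : 0 ≤ φ := by rw [hφ]; linarith [hx.1]
    have hφ1 : φ ≤ δ := by rw [hφ]; linarith [hx.2]
    rw [← hφ]
    have e : ν * (((w'' x * φ ^ 2 + w' x * (2 * φ)) * w x - w' x * φ ^ 2 * w' x) / w x ^ 2)
        = (g2 (v x ^ 2) - l2) * φ ^ 2 + ν * (1 - (1 - φ * (w' x / w x)) ^ 2) := by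
      have : ν * (((w'' x * φ ^ 2 + w' x * (2 * φ)) * w x - w' x * φ ^ 2 * w' x) / w x ^ 2)
        = (ν * w'' x) / w x * φ ^ 2 + ν * (1 - (1 - φ * (w' x / w x)) ^ 2) := by
        field_simp
        ring
      rw [this, he]
      field_simp
    rw [e]
    have k0 := mul_nonneg hν.le (sq_nonneg (1 - φ * (w' x / w x)))
    have k1 : g2 (v x ^ 2) * φ ^ 2 ≤ 8 * C ^ 2 * δ ^ 2 * ν * v'' x := by
      have hnn : 0 ≤ v x * v x := by positivity
      calc g2 (v x ^ 2) * φ ^ 2 ≤ (C * v x ^ 2) * φ ^ 2 := by gcongr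
        _ = C * (v x * v x) * φ ^ 2 := by ring
        _ ≤ C * (2 * v x) * δ ^ 2 := by gcongr
        _ ≤ C * (2 * (4 * C * (ν * v'' x))) * δ ^ 2 := by gcongr
        _ = _ := by ring
    linarith
  have := hmon (left_mem_Icc.2 ex.2) (right_mem_Icc.2 ex.2) ex.2
  simp only [S.v1, S.w1] at this
  norm_num at this
  have k : 8 * C ^ 2 * δ ^ 2 * ν * (-8) ≤ 8 * C ^ 2 * δ ^ 2 * ν * v' (1 - δ) := by gcongr
  linarith

/-- Case where only `v` may be large. -/
lemma v_bound (S : Sol C ν g1 g2 v v' v'' w w' w'' A B l1 l2) {K : ℝ}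
    (hK : K = 320 * C ^ 3) (hN : w 1 ≤ K) : v 0 ≤ 8 * C ^ 2 * K := by
  by_contra hM
  push Not at hM
  have hC := S.hC
  have hν := S.hν
  have hl1 := S.l1_pos
  have hl2 := S.l2_pos
  have hl2C := S.l2_le
  have hC2 : 1 ≤ C ^ 2 := one_le_pow₀ hC
  have hC3 : 1 ≤ C ^ 3 := one_le_pow₀ hC
  have hK1 : 320 ≤ K := by rw [hK]; linarith
  have hCK : C ^ 2 ≤ K := by
    have : C ^ 2 ≤ C ^ 3 := pow_le_pow_right₀ hC (by norm_num)
    rw [hK]; linarith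
  have hMK : K < v 0 := by nlinarith
  have hMsq : 64 * C ^ 4 * K ^ 2 ≤ v 0 ^ 2 := by
    have := pow_le_pow_left₀ (by positivity) hM.le 2
    calc 64 * C ^ 4 * K ^ 2 = (8 * C ^ 2 * K) ^ 2 := by ring
      _ ≤ _ := this
  have hKsq : K ^ 2 ≤ v 0 ^ 2 := pow_le_pow_left₀ (by linarith) hMK.le 2
  have hKC : K ^ 2 = 102400 * C ^ 6 := by rw [hK]; ring
  have hC6 : 1 ≤ C ^ 6 := one_le_pow₀ hC
  have e1 : (1:ℝ) ∈ Icc (0:ℝ) 1 := right_mem_Icc.2 zero_le_one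
  have hw1 := S.pw 1 e1
  have hNsq : w 1 ^ 2 ≤ K ^ 2 := pow_le_pow_left₀ hw1.le hN 2
  -- Hamiltonian at 1
  have hl : l1 * v 0 ^ 2 ≤ 2 * C ^ 2 * K ^ 2 * l2 := by
    have h1 := S.ham e1
    have h2 := S.w0_small (by linarith) (by linarith)
    have h3 := S.v_sq e1
    simp only [S.v1, S.w1] at h1
    have q1 : l1 * v 1 ^ 2 ≤ l1 * 1 := by gcongr; linarith
    have q2 : C ^ 2 * (l2 * w 1 ^ 2) ≤ C ^ 2 * (l2 * K ^ 2) := by gcongr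
    have q3 : l1 * 4 ≤ l1 * v 0 ^ 2 := by gcongr; linarith
    nlinarith
  have hl1s : l1 ≤ 1 / (4 * C) := by
    rw [le_div_iff₀ (by positivity)]
    have : l1 * (64 * C ^ 4 * K ^ 2) ≤ 2 * C ^ 2 * K ^ 2 * C :=
      calc l1 * (64 * C ^ 4 * K ^ 2) ≤ l1 * v 0 ^ 2 := by gcongr
        _ ≤ 2 * C ^ 2 * K ^ 2 * l2 := hl
        _ ≤ _ := by gcongr
    have : (l1 * (4 * C)) * (16 * C ^ 3 * K ^ 2) ≤ (1 / 8) * (16 * C ^ 3 * K ^ 2) := by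
      calc _ = l1 * (64 * C ^ 4 * K ^ 2) := by ring
        _ ≤ _ := this
        _ = _ := by ring
    have := le_of_mul_le_mul_right this (by positivity)
    linarith
  obtain ⟨δ, hδ⟩ : ∃ δ, δ = 1 / (2 * K ^ 2) := ⟨_, rfl⟩
  have hδp : 0 < δ := by rw [hδ]; positivity
  have hδK : δ * K ^ 2 = 1 / 2 := by rw [hδ]; field_simp
  have hδh : δ ≤ 1 / 2 := by nlinarith
  have ex : 1 - δ ∈ Icc (0:ℝ) 1 := ⟨by linarith, by linarith⟩
  have hwx := S.pw _ ex
  have hwl : 1 / 2 ≤ w (1 - δ) ^ 2 := by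
    have m1 := aux_mvt_ge (c := w (1 - δ) ^ 2) ex.1 S.dB (fun y hy => by
      have hy1 : y ∈ Icc (0:ℝ) 1 := ⟨hy.1, hy.2.trans ex.2⟩
      exact pow_le_pow_left₀ (S.pw y hy1).le (S.mw hy1 ex hy.2) 2)
    have m2 := aux_mvt_ge (c := K ^ 2) ex.2 S.dB (fun y hy => by
      have hy1 : y ∈ Icc (0:ℝ) 1 := ⟨ex.1.trans hy.1, hy.2⟩
      exact (pow_le_pow_left₀ (S.pw y hy1).le (S.mw hy1 e1 hy.2) 2).trans hNsq)
    rw [S.B0] at m1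
    rw [S.B1] at m2
    nlinarith
  -- v ≤ 4 C ν v'' on [1-δ,1]
  have hvv : ∀ y ∈ Icc (1 - δ) 1, v y ≤ 4 * C * (ν * v'' y) := by
    intro y hy
    have hy1 : y ∈ Icc (0:ℝ) 1 := ⟨ex.1.trans hy.1, hy.2⟩
    have h1 : w (1 - δ) ^ 2 ≤ w y ^ 2 := pow_le_pow_left₀ hwx.le (S.mw ex hy1 hy.1) 2
    have h2 := (S.g1b (w y ^ 2) (sq_nonneg _)).1
    rw [le_div_iff₀ (by positivity)] at hl1s
    have h3 := S.pv y hy1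
    rw [S.ev y hy1]
    nlinarith
  have hl2ν := S.l2_small (by linarith) hδp hδh hvv
  have hl2K : l2 ≤ 13 * K ^ 4 * ν := by
    have h1 : l2 * δ ^ 3 / 3 * (24 * K ^ 6) = l2 := by
      calc _ = l2 * 8 * (δ * K ^ 2) ^ 3 := by ring
        _ = l2 := by rw [hδK]; ring
    have h2 : (ν * δ + 64 * C ^ 2 * δ ^ 2 * ν) * (24 * K ^ 6)
        = 12 * K ^ 4 * ν + 384 * C ^ 2 * K ^ 2 * ν := by
      calc _ = 24 * ν * K ^ 4 * (δ * K ^ 2) + 1536 * C ^ 2 * K ^ 2 * ν * (δ * K ^ 2) ^ 2 := by ring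
        _ = _ := by rw [hδK]; ring
    have h3 := mul_le_mul_of_nonneg_right hl2ν (by positivity : 0 ≤ 24 * K ^ 6)
    rw [h1, h2] at h3
    have h4 : 384 * C ^ 2 * K ^ 2 * ν ≤ K ^ 2 * K ^ 2 * ν := by
      have : C ^ 2 ≤ C ^ 6 := pow_le_pow_right₀ hC (by norm_num)
      gcongr
      linarith
    nlinarith
  obtain ⟨-, h9⟩ := S.l1_big (by linarith)
  have f1 : ν * v 0 ^ 6 ≤ ν * (416 * C ^ 2 * K ^ 6) :=
    calc ν * v 0 ^ 6 = (ν * v 0 ^ 4) * v 0 ^ 2 := by ring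
      _ ≤ (16 * l1) * v 0 ^ 2 := by gcongr
      _ = 16 * (l1 * v 0 ^ 2) := by ring
      _ ≤ 16 * (2 * C ^ 2 * K ^ 2 * (13 * K ^ 4 * ν)) := by
        have : 2 * C ^ 2 * K ^ 2 * l2 ≤ 2 * C ^ 2 * K ^ 2 * (13 * K ^ 4 * ν) := by gcongr
        linarith
      _ = _ := by ring
  have f2 := le_of_mul_le_mul_left f1 hν
  have f3 : (8 * C ^ 2 * K) ^ 6 ≤ v 0 ^ 6 := pow_le_pow_left₀ (by positivity) hM.le 6
  have f4 : 262144 * C ^ 2 * K ^ 6 ≤ (8 * C ^ 2 * K) ^ 6 := by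
    calc _ ≤ 262144 * C ^ 12 * K ^ 6 := by gcongr; norm_num
      _ = _ := by ring
  have : 0 < C ^ 2 * K ^ 6 := by positivity
  linarith

lemma bound (S : Sol C ν g1 g2 v v' v'' w w' w'' A B l1 l2) :
    v 0 ≤ 2560 * C ^ 5 ∧ w 1 ≤ 2560 * C ^ 5 := by
  have hC := S.hC
  have h35 : C ^ 3 ≤ C ^ 5 := pow_le_pow_right₀ hC (by norm_num)
  have h0 : 0 < C ^ 3 := by positivity
  have e : 8 * C ^ 2 * (320 * C ^ 3) = 2560 * C ^ 5 := by ring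
  rcases le_or_gt (w 1) (320 * C ^ 3) with h | h
  · have := S.v_bound rfl h
    exact ⟨by linarith, by linarith⟩
  · rcases le_or_gt (v 0) (320 * C ^ 3) with h' | h'
    · have := S.swap.v_bound rfl (by simpa using h')
      simp only [sub_zero] at this
      exact ⟨by linarith, by linarith⟩
    · exact (S.not_both h' h).elim

end Sol

lemma aux_nonpos {f f' : ℝ → ℝ} (hf : ∀ x, HasDerivAt f (f' x) x) (h0 : f' 0 = 0)
    (h1 : f' 1 = 0) (ha : AntitoneOn f (Icc 0 1)) : ∀ x ∈ Icc (0:ℝ) 1, f' x ≤ 0 := by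
  intro x hx
  rcases eq_or_lt_of_le hx.1 with h | h
  · rw [← h, h0]
  rcases eq_or_lt_of_le hx.2 with h2 | h2
  · rw [h2, h1]
  have := ha.derivWithin_nonpos (x := x)
  rwa [derivWithin_of_mem_nhds (Icc_mem_nhds h h2), (hf x).deriv] at this

lemma aux_toSol {Cg ν : ℝ} {g₁ g₂ v₁ v₂ : ℝ → ℝ} {l₁ l₂ : ℝ} (hCg : 0 < Cg) (hg₁ : GAss Cg g₁)
    (hg₂ : GAss Cg g₂) (hν : 0 < ν) (hs : IsSolution ν g₁ g₂ v₁ v₂ l₁ l₂)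
    (ha : AntitoneOn v₁ (Icc 0 1)) (hm : MonotoneOn v₂ (Icc 0 1)) :
    Sol Cg ν g₁ g₂ v₁ (deriv v₁) (deriv (deriv v₁)) v₂ (deriv v₂) (deriv (deriv v₂))
      (fun x => ∫ t in (0:ℝ)..x, (v₁ t) ^ 2) (fun x => ∫ t in (0:ℝ)..x, (v₂ t) ^ 2) l₁ l₂ := by
  obtain ⟨c1, c2, e1, e2, p1, p2, b1, b2, b3, b4, i1, i2⟩ := hs
  obtain ⟨-, m1, q1⟩ := hg₁
  obtain ⟨-, m2, q2⟩ := hg₂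
  have hd : ∀ f : ℝ → ℝ, ContDiff ℝ 2 f → (∀ x, HasDerivAt f (deriv f x) x) ∧
      ∀ x, HasDerivAt (deriv f) (deriv (deriv f) x) x := by
    intro f hf
    have h1 : ContDiff ℝ 1 (deriv f) := by
      have : ContDiff ℝ (1 + 1) f := by
        convert hf using 1
        norm_num
      exact (contDiff_succ_iff_deriv.1 this).2.2
    exact ⟨fun x => ((hf.differentiable (by norm_num)) x).hasDerivAt,
      fun x => ((h1.differentiable (by norm_num)) x).hasDerivAt⟩
  have hI : ∀ f : ℝ → ℝ, ContDiff ℝ 2 f → ∀ x,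
      HasDerivAt (fun x => ∫ t in (0:ℝ)..x, (f t) ^ 2) (f x ^ 2) x := by
    intro f hf x
    have hc : Continuous (fun t => f t ^ 2) := hf.continuous.pow 2
    exact intervalIntegral.integral_hasDerivAt_right (hc.intervalIntegrable _ _)
      (hc.stronglyMeasurableAtFilter _ _) hc.continuousAt
  have hb : ∀ g : ℝ → ℝ, (∀ s : ℝ, 0 ≤ s → Cg⁻¹ * s ≤ g s ∧ g s ≤ Cg * s) →
      ∀ s, 0 ≤ s → s ≤ Cg * g s ∧ g s ≤ Cg * s := by
    intro g hg s hs
    refine ⟨?_, (hg s hs).2⟩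
    have := mul_le_mul_of_nonneg_left (hg s hs).1 hCg.le
    rwa [← mul_assoc, mul_inv_cancel₀ hCg.ne', one_mul] at this
  have hC1 : 1 ≤ Cg := by
    have h1 := (hb g₁ q1 1 zero_le_one).1
    have h2 := (hb g₁ q1 1 zero_le_one).2
    nlinarith
  exact
  { hC := hC1, hν := hν, g1b := hb g₁ q1, g2b := hb g₂ q2
    g1m := m1.monotoneOn, g2m := m2.monotoneOn
    dv := (hd _ c1).1, dv' := (hd _ c1).2, dw := (hd _ c2).1, dw' := (hd _ c2).2
    dA := hI _ c1, dB := hI _ c2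
    A0 := by simp
    A1 := i1
    B0 := by simp
    B1 := i2
    ev := fun x hx => by linarith [e1 x hx]
    ew := fun x hx => by linarith [e2 x hx]
    pv := p1, pw := p2, v0 := b1, v1 := b2, w0 := b3, w1 := b4
    nv := aux_nonpos (hd _ c1).1 b1 b2 ha
    nw := fun x hx => by
      have := aux_nonpos (f := fun x => - v₂ x) (f' := fun x => - deriv v₂ x)
        (fun x => ((hd _ c2).1 x).neg) (by simp [b3]) (by simp [b4])
        (fun a ha b hb hab => neg_le_neg (hm ha hb hab)) x hx
      linarith
    av := ha, mw := hm }

theorem stmt_19 (Cg : ℝ) (g₁ g₂ : ℝ → ℝ)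
    (ν l₁ l₂ : ℕ → ℝ) (v₁ v₂ : ℕ → ℝ → ℝ)
    (hCg : 0 < Cg) (hg₁ : GAss Cg g₁) (hg₂ : GAss Cg g₂)
    (hν : ∀ n, 0 < ν n)
    (hsol : ∀ n, IsSolution (ν n) g₁ g₂ (v₁ n) (v₂ n) (l₁ n) (l₂ n))
    (hnt : ∀ n, ¬ IsTrivialSol (v₁ n) (v₂ n))
    (hmono : ∀ n, AntitoneOn (v₁ n) (Set.Icc 0 1) ∧ MonotoneOn (v₂ n) (Set.Icc 0 1))
    (hν0 : Tendsto ν atTop (nhds 0)) :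
    ∃ Cinf > 0, ∀ n, ∀ x ∈ Set.Icc (0:ℝ) 1, |v₁ n x| ≤ Cinf ∧ |v₂ n x| ≤ Cinf := by
  have hS := fun n => aux_toSol hCg hg₁ hg₂ (hν n) (hsol n) (hmono n).1 (hmono n).2
  refine ⟨2560 * Cg ^ 5, by positivity, fun n x hx => ?_⟩
  have hb := (hS n).bound
  have h1 := (hmono n).1 (left_mem_Icc.2 zero_le_one) hx hx.1
  have h2 := (hmono n).2 hx (right_mem_Icc.2 zero_le_one) hx.2
  rw [abs_of_pos ((hS n).pv x hx), abs_of_pos ((hS n).pw x hx)]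
  exact ⟨h1.trans hb.1, h2.trans hb.2⟩
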